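/- If G is a finite nonabelian simple group, then CD(G) = {1, G}. -/

import Mathlib

/-- The Chermak-Delgado measure of a subgroup `H` of `G`: `|H| * |C_G(H)|`. -/
noncomputable def cdMeasure {G : Type*} [Group G] (H : Subgroup G) : ℕ :=
  Nat.card H * Nat.card (Subgroup.centralizer (H : Set G))

/-- The Chermak-Delgado lattice: subgroups of maximal Chermak-Delgado measure. -/
def CD (G : Type*) [Group G] : Set (Subgroup G) :=
  {H : Subgroup G | ∀ K : Subgroup G, cdMeasure K ≤ cdMeasure H}

open scoped Pointwise in
theorem card_mul_card_le_aux {G : Type*} [Group G] [Finite G] (H K : Subgroup G) :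
    Nat.card H * Nat.card K ≤ Nat.card ((H : Set G) * (K : Set G) : Set G) * Nat.card (H ⊓ K : Subgroup G) := by
  have hx : ∀ x : ((H : Set G) * (K : Set G) : Set G), ∃ p : G × G, p.1 ∈ H ∧ p.2 ∈ K ∧ p.1 * p.2 = x := by
    rintro ⟨x, h, hh, k, hk, rfl⟩
    exact ⟨(h, k), hh, hk, rfl⟩
  choose p hp1 hp2 hp3 using hx
  rw [← Nat.card_prod, ← Nat.card_prod]
  let m : H × K → ((H : Set G) * (K : Set G) : Set G) :=
    fun q => ⟨q.1 * q.2, Set.mul_mem_mul q.1.2 q.2.2⟩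
  refine Nat.card_le_card_of_injective
    (fun q : H × K => (m q, (⟨(p (m q)).1⁻¹ * q.1, ?_⟩ : (H ⊓ K : Subgroup G)))) ?_
  · refine ⟨H.mul_mem (H.inv_mem (hp1 _)) q.1.2, ?_⟩
    have h3 : (p (m q)).1 * (p (m q)).2 = q.1 * q.2 := hp3 (m q)
    have : (p (m q)).1⁻¹ * (q.1 : G) = (p (m q)).2 * (q.2 : G)⁻¹ := by
      rw [inv_mul_eq_iff_eq_mul, ← mul_assoc, h3, mul_inv_cancel_right]
    rw [this]
    exact K.mul_mem (hp2 _) (K.inv_mem q.2.2)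
  · intro q r hqr
    simp only [Prod.mk.injEq] at hqr
    obtain ⟨h1, h2⟩ := hqr
    have h2 : (p (m q)).1⁻¹ * (q.1 : G) = (p (m r)).1⁻¹ * (r.1 : G) := congrArg Subtype.val h2
    rw [h1] at h2
    have e1 : (q.1 : G) = r.1 := mul_left_cancel h2
    have h4 : (q.1 : G) * q.2 = r.1 * r.2 := congrArg Subtype.val h1
    rw [e1] at h4
    exact Prod.ext (Subtype.ext e1) (Subtype.ext (mul_left_cancel h4))

open scoped Pointwise in
theorem CD_sup_aux {G : Type*} [Group G] [Finite G] {H K : Subgroup G}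
    (hH : H ∈ CD G) (hK : K ∈ CD G) :
    H ⊔ K ∈ CD G ∧ ((H : Set G) * (K : Set G) : Set G) = (H ⊔ K : Subgroup G) := by
  have a1 := card_mul_card_le_aux H K
  have a2 := card_mul_card_le_aux (Subgroup.centralizer (H : Set G)) (Subgroup.centralizer (K : Set G))
  have sub : ((H : Set G) * (K : Set G) : Set G) ⊆ (H ⊔ K : Subgroup G) :=
    Subgroup.mul_subset (SetLike.coe_subset_coe.2 le_sup_left) (SetLike.coe_subset_coe.2 le_sup_right)
  have hc : (Subgroup.centralizer (H : Set G) ⊓ Subgroup.centralizer (K : Set G))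
      = Subgroup.centralizer ((H ⊔ K : Subgroup G) : Set G) := by
    apply le_antisymm
    · rw [Subgroup.le_centralizer_iff]
      refine sup_le ?_ ?_
      · rw [Subgroup.le_centralizer_iff]; exact inf_le_left
      · rw [Subgroup.le_centralizer_iff]; exact inf_le_right
    · exact le_inf (Subgroup.centralizer_le (SetLike.coe_subset_coe.2 le_sup_left))
        (Subgroup.centralizer_le (SetLike.coe_subset_coe.2 le_sup_right))
  rw [hc] at a2
  have a3 : Nat.card ((Subgroup.centralizer (H : Set G) : Set G) * (Subgroup.centralizer (K : Set G) : Set G) : Set G)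
      ≤ Nat.card (Subgroup.centralizer ((H ⊓ K : Subgroup G) : Set G)) := by
    refine Nat.card_mono (Set.toFinite _) (Subgroup.mul_subset ?_ ?_)
    · exact Subgroup.centralizer_le (SetLike.coe_subset_coe.2 inf_le_left)
    · exact Subgroup.centralizer_le (SetLike.coe_subset_coe.2 inf_le_right)
  have a4 : Nat.card ((H : Set G) * (K : Set G) : Set G) ≤ Nat.card (H ⊔ K : Subgroup G) :=
    Nat.card_mono (Set.toFinite _) sub
  have b1 := hH (H ⊓ K)
  have b2 := hH (H ⊔ K)
  have b3 := hH K
  have b4 := hK H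
  have pos : 0 < cdMeasure H := Nat.mul_pos Nat.card_pos Nat.card_pos
  have posc : 0 < Nat.card (Subgroup.centralizer ((H ⊔ K : Subgroup G) : Set G)) := Nat.card_pos
  have e : cdMeasure K = cdMeasure H := le_antisymm b3 b4
  have key : cdMeasure H ≤ Nat.card ((H : Set G) * (K : Set G) : Set G) *
      Nat.card (Subgroup.centralizer ((H ⊔ K : Subgroup G) : Set G)) := by
    refine Nat.le_of_mul_le_mul_right ?_ pos
    nth_rewrite 2 [← e]
    calc cdMeasure H * cdMeasure K
        = (Nat.card H * Nat.card K) * (Nat.card (Subgroup.centralizer (H : Set G)) *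
          Nat.card (Subgroup.centralizer (K : Set G))) := by unfold cdMeasure; ring
      _ ≤ _ := Nat.mul_le_mul a1 (a2.trans (Nat.mul_le_mul_right _ a3))
      _ = (Nat.card ((H : Set G) * (K : Set G) : Set G) *
      Nat.card (Subgroup.centralizer ((H ⊔ K : Subgroup G) : Set G))) * cdMeasure (H ⊓ K) := by
          unfold cdMeasure; ring
      _ ≤ _ := Nat.mul_le_mul_left _ b1
  refine ⟨fun L => (hH L).trans (key.trans (Nat.mul_le_mul_right _ a4)), ?_⟩
  refine Set.eq_of_subset_of_ncard_le sub ?_ (Set.toFinite _)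
  exact Nat.le_of_mul_le_mul_right (b2.trans key) posc

open scoped Pointwise in
theorem CD_conj_aux {G : Type*} [Group G] [Finite G] {H : Subgroup G}
    (hH : H ∈ CD G) (g : G) : MulAut.conj g • H ∈ CD G := by
  have e : cdMeasure H ≤ cdMeasure (MulAut.conj g • H) := by
    unfold cdMeasure
    refine Nat.mul_le_mul ?_ ?_
    · exact (Nat.card_congr (Subgroup.equivSMul (MulAut.conj g) H).toEquiv).le
    · rw [Nat.card_congr (Subgroup.equivSMul (MulAut.conj g)
        (Subgroup.centralizer (H : Set G))).toEquiv]
      refine Nat.card_mono (Set.toFinite _) ?_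
      rintro _ ⟨c, hc, rfl⟩
      refine Subgroup.mem_centralizer_iff.2 ?_
      rintro _ ⟨x, hx, rfl⟩
      have := Subgroup.mem_centralizer_iff.1 hc x hx
      simp only [MulDistribMulAction.toMonoidEnd_apply, MulDistribMulAction.toMonoidHom_apply]
      rw [← smul_mul', this, smul_mul']
  exact fun K => (hH K).trans e

open scoped Pointwise in
theorem normal_aux {G : Type*} [Group G] {H : Subgroup G}
    (h : ∀ g : G, MulAut.conj g • H ≤ H) : H.Normal :=
  ⟨fun n hn g => h g (Subgroup.smul_mem_pointwise_smul n (MulAut.conj g) H hn)⟩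

open scoped Pointwise in
theorem stmt_11 {G : Type*} [Group G] [Finite G] [IsSimpleGroup G]
    (h : ¬ ∀ a b : G, a * b = b * a) :
    CD G = {(⊥ : Subgroup G), ⊤} := by
  have hz : Subgroup.center G = ⊥ := by
    rcases (inferInstance : (Subgroup.center G).Normal).eq_bot_or_eq_top with h1 | h1
    · exact h1
    · refine absurd (fun a b => ?_) h
      have : b ∈ Subgroup.center G := h1 ▸ Subgroup.mem_top b
      exact Subgroup.mem_center_iff.1 this a
  have mb : cdMeasure (⊥ : Subgroup G) = Nat.card G := by
    have : Subgroup.centralizer ((⊥ : Subgroup G) : Set G) = ⊤ := by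
      rw [Subgroup.centralizer_eq_top_iff_subset]; exact SetLike.coe_subset_coe.2 bot_le
    unfold cdMeasure; rw [this]; simp
  have mt : cdMeasure (⊤ : Subgroup G) = Nat.card G := by
    unfold cdMeasure
    rw [Subgroup.coe_top, Subgroup.centralizer_univ, hz]; simp
  -- a maximal member
  have ne : (CD G).Nonempty := by
    obtain ⟨H, hH⟩ := Finite.exists_max (cdMeasure (G := G))
    exact ⟨H, hH⟩
  obtain ⟨T, hT⟩ := (Set.toFinite (CD G)).exists_maximal ne
  have hTn : T.Normal := normal_aux fun g =>
    le_trans le_sup_right (hT.2 (CD_sup_aux hT.1 (CD_conj_aux hT.1 g)).1 le_sup_left)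
  have hmax : ∀ K : Subgroup G, cdMeasure K ≤ Nat.card G := by
    intro K
    rcases hTn.eq_bot_or_eq_top with h1 | h1
    · exact (hT.1 K).trans (by rw [h1, mb])
    · exact (hT.1 K).trans (by rw [h1, mt])
  apply Set.Subset.antisymm
  · intro H hH
    by_cases hHt : H = ⊤
    · exact Or.inr hHt
    left
    obtain ⟨M, hHM, hM⟩ := (Set.toFinite {K | K ∈ CD G ∧ K ≠ ⊤}).exists_le_maximal
      (show H ∈ {K | K ∈ CD G ∧ K ≠ ⊤} from ⟨hH, hHt⟩)
    have hMn : M.Normal := normal_aux fun g => by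
      obtain ⟨s1, s2⟩ := CD_sup_aux hM.1.1 (CD_conj_aux hM.1.1 g)
      by_cases ht : M ⊔ MulAut.conj g • M = ⊤
      · have hg : g⁻¹ ∈ (M : Set G) * ((MulAut.conj g • M : Subgroup G) : Set G) := by
          rw [s2, ht]; trivial
        obtain ⟨a, ha, _, ⟨k, hk, rfl⟩, hak⟩ := hg
        have hak' : a * (g * k * g⁻¹) = g⁻¹ := hak
        have : g = a⁻¹ * k⁻¹ := by
          have h5 : a * g * k = 1 := by
            have := congrArg (· * g) hak'
            simpa [mul_assoc] using this
          rw [mul_eq_one_iff_eq_inv] at h5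
          rw [← h5, inv_mul_cancel_left]
        have hgM : g ∈ M := this ▸ M.mul_mem (M.inv_mem ha) (M.inv_mem hk)
        rintro _ ⟨y, hy, rfl⟩
        exact M.mul_mem (M.mul_mem hgM hy) (M.inv_mem hgM)
      · exact le_trans le_sup_right (hM.2 ⟨s1, ht⟩ le_sup_left)
    rcases hMn.eq_bot_or_eq_top with h1 | h1
    · exact le_bot_iff.1 (h1 ▸ hHM)
    · exact absurd h1 hM.1.2
  · rintro H (rfl | rfl)
    · exact fun K => (hmax K).trans mb.ge
    · exact fun K => (hmax K).trans mt.ge
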